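/- arXiv:2105.09602 — 3 statements merged into one kernel-verified Lean document; each statement's English description precedes it below -/
import Mathlib

section
/- With partial order preference lists, the super-stable matching polytope is still described by the same linear system: a vector x ∈ ℝ^E is an extreme point of the polytope defined by (a) ∑_{u ∈ N(v)} x_{u,v} ≤ 1 for all v ∈ V, (b) ∑_{i ≻_u v} x_{u,i} + ∑_{j ≻_v u} x_{j,v} + x_{u,v} ≥ 1 for all (u,v) ∈ E, and (c) x ≥ 0, if and only if x is the incidence vector χ^M of a super-stable matching M of G. -/
open scoped Classical

/-- An instance of the super-stable matching problem with partial order preference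
lists: a finite bipartite graph where each vertex has an arbitrary strict partial
order on its neighbors. `sprefA a b b'` means `b ≻_a b'`. -/
structure POInstance (A B : Type*) where
  E : Finset (A × B)
  sprefA : A → B → B → Prop
  sprefB : B → A → A → Prop
  sprefA_irrefl : ∀ a b, ¬ sprefA a b b
  sprefA_trans : ∀ a b₁ b₂ b₃, sprefA a b₁ b₂ → sprefA a b₂ b₃ → sprefA a b₁ b₃
  sprefB_irrefl : ∀ b a, ¬ sprefB b a a
  sprefB_trans : ∀ b a₁ a₂ a₃, sprefB b a₁ a₂ → sprefB b a₂ a₃ → sprefB b a₁ a₃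

namespace POInstance

variable {A B : Type*}

/-- A matching: a set of pairwise disjoint edges of the graph. -/
def IsMatching (I : POInstance A B) (M : Finset (A × B)) : Prop :=
  M ⊆ I.E ∧
  (∀ p ∈ M, ∀ q ∈ M, p.1 = q.1 → p = q) ∧
  (∀ p ∈ M, ∀ q ∈ M, p.2 = q.2 → p = q)

/-- `(a,b)` is a blocking edge for `M`: it is an edge outside `M` and neither
endpoint would become worse off by matching with the other. -/
def Blocks (I : POInstance A B) (M : Finset (A × B)) (a : A) (b : B) : Prop :=
  (a, b) ∈ I.E ∧ (a, b) ∉ M ∧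
  (∀ b', (a, b') ∈ M → ¬ I.sprefA a b' b) ∧
  (∀ a', (a', b) ∈ M → ¬ I.sprefB b a' a)

/-- A super-stable matching: a matching with no blocking edge. -/
def SuperStable (I : POInstance A B) (M : Finset (A × B)) : Prop :=
  I.IsMatching M ∧ ∀ a b, ¬ I.Blocks M a b

/-- The incidence vector `χ^M` of a set of edges `M`. -/
noncomputable def chi (M : Finset (A × B)) : A × B → ℝ :=
  fun p => if p ∈ M then 1 else 0

/-- `x ∈ ℝ^E` is a feasible solution of the super-stable matching linear system
(a)–(c) for partial order preference lists. -/
def Feasible (I : POInstance A B) (x : A × B → ℝ) : Prop :=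
  (∀ p, p ∉ I.E → x p = 0) ∧
  (∀ a : A, (∑ p ∈ I.E.filter (fun p => p.1 = a), x p) ≤ 1) ∧
  (∀ b : B, (∑ p ∈ I.E.filter (fun p => p.2 = b), x p) ≤ 1) ∧
  (∀ p ∈ I.E,
    (∑ q ∈ I.E.filter (fun q => q.1 = p.1 ∧ I.sprefA p.1 q.2 p.2), x q) +
    (∑ q ∈ I.E.filter (fun q => q.2 = p.2 ∧ I.sprefB p.2 q.1 p.1), x q) +
    x p ≥ 1) ∧
  (∀ p, 0 ≤ x p)

end POInstance

section Sums

variable {ι : Type*}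

/-- Splitting a quadratic form supported on a symmetric relation `s` according to an
asymmetric relation `R ⊆ s`. -/
lemma sum_mul_sum_filter_eq (E : Finset ι) (x : ι → ℝ) (s R : ι → ι → Prop)
    (hrefl : ∀ p, s p p) (hsymm : ∀ p q, s p q → s q p)
    (hRs : ∀ p q, R p q → s p q) (hR : ∀ p q, R p q → ¬ R q p) :
    ∑ p ∈ E, x p * ∑ q ∈ E.filter (fun q => s q p), x q =
      2 * ∑ p ∈ E, x p * ∑ q ∈ E.filter (fun q => R q p), x q + ∑ p ∈ E, x p * x p +
      ∑ p ∈ E, x p *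
        ∑ q ∈ E.filter (fun q => s q p ∧ q ≠ p ∧ ¬ R q p ∧ ¬ R p q), x q := by
  have hswap : ∑ p ∈ E, x p * ∑ q ∈ E.filter (fun q => R q p), x q =
      ∑ p ∈ E, x p * ∑ q ∈ E.filter (fun q => R p q), x q := by
    simp only [Finset.sum_filter, Finset.mul_sum]
    rw [Finset.sum_comm]
    refine Finset.sum_congr rfl fun p _ => Finset.sum_congr rfl fun q _ => ?_
    split_ifs <;> ring
  have hdiag : ∑ p ∈ E, x p * x p =
      ∑ p ∈ E, x p * ∑ q ∈ E.filter (fun q => q = p), x q := by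
    refine Finset.sum_congr rfl fun p hp => ?_
    rw [Finset.sum_filter, Finset.sum_ite_eq' E p x, if_pos hp]
  rw [two_mul]
  nth_rewrite 2 [hswap]
  rw [hdiag, ← Finset.sum_add_distrib, ← Finset.sum_add_distrib, ← Finset.sum_add_distrib]
  refine Finset.sum_congr rfl fun p _ => ?_
  rw [← mul_add, ← mul_add, ← mul_add]
  congr 1
  simp only [Finset.sum_filter]
  rw [← Finset.sum_add_distrib, ← Finset.sum_add_distrib, ← Finset.sum_add_distrib]
  refine Finset.sum_congr rfl fun q _ => ?_
  have h1 := hrefl p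
  have h2 := hsymm p q
  have h3 := hRs p q
  have h4 := hRs q p
  have h5 := hR p q
  have h6 := hR p p
  by_cases e : q = p
  · subst e
    by_cases r : R q q <;> simp_all
  · by_cases r : R p q <;> by_cases r' : R q p <;> by_cases t : s q p <;> simp_all

lemma add_sum_le_sum {s t : Finset ι} {x : ι → ℝ} {m : ι} (hx : ∀ p, 0 ≤ x p)
    (hm : m ∉ s) (hmt : m ∈ t) (hst : s ⊆ t) : ∑ q ∈ s, x q + x m ≤ ∑ q ∈ t, x q := by
  rw [add_comm, ← Finset.sum_insert hm]
  exact Finset.sum_le_sum_of_subset_of_nonneg (Finset.insert_subset hmt hst) fun p _ _ => hx p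

lemma eventually_le_add_mul_sub {c g h : ℝ} (hg : c ≤ g) (hh : g = c → h ≤ c) :
    ∀ᶠ δ in nhdsWithin (0 : ℝ) (Set.Ioi 0), c ≤ g + δ * (g - h) := by
  rcases hg.lt_or_eq with hlt | heq
  · have hcont : Filter.Tendsto (fun δ : ℝ => g + δ * (g - h)) (nhds 0) (nhds g) := by
      have : Continuous fun δ : ℝ => g + δ * (g - h) := by fun_prop
      simpa using this.tendsto 0
    exact ((hcont.eventually (lt_mem_nhds hlt)).filter_mono nhdsWithin_le_nhds).mono
      fun _ h => h.le
  · filter_upwards [self_mem_nhdsWithin] with δ hδ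
    have := mul_nonneg (le_of_lt hδ) (sub_nonneg.2 (hh heq.symm))
    rw [← heq]
    linarith

end Sums

namespace POInstance

variable {A B : Type*} {I : POInstance A B} {x y : A × B → ℝ} {M : Finset (A × B)}

/-- The total weight of the edges at `a`. -/
noncomputable def degA (I : POInstance A B) (x : A × B → ℝ) (a : A) : ℝ :=
  ∑ p ∈ I.E.filter (fun p => p.1 = a), x p

/-- The total weight of the edges at `b`. -/
noncomputable def degB (I : POInstance A B) (x : A × B → ℝ) (b : B) : ℝ :=
  ∑ p ∈ I.E.filter (fun p => p.2 = b), x p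

/-- The total weight of the edges that `p.1` strictly prefers to `p`. -/
noncomputable def upA (I : POInstance A B) (x : A × B → ℝ) (p : A × B) : ℝ :=
  ∑ q ∈ I.E.filter (fun q => q.1 = p.1 ∧ I.sprefA p.1 q.2 p.2), x q

/-- The total weight of the edges that `p.2` strictly prefers to `p`. -/
noncomputable def upB (I : POInstance A B) (x : A × B → ℝ) (p : A × B) : ℝ :=
  ∑ q ∈ I.E.filter (fun q => q.2 = p.2 ∧ I.sprefB p.2 q.1 p.1), x q

lemma feasible_iff : I.Feasible x ↔ (∀ p, p ∉ I.E → x p = 0) ∧ (∀ a, I.degA x a ≤ 1) ∧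
    (∀ b, I.degB x b ≤ 1) ∧ (∀ p ∈ I.E, I.upA x p + I.upB x p + x p ≥ 1) ∧ ∀ p, 0 ≤ x p :=
  Iff.rfl

lemma sum_add_mul_sub (s : Finset (A × B)) (δ : ℝ) :
    ∑ p ∈ s, (x p + δ * (x p - y p)) =
      ∑ p ∈ s, x p + δ * (∑ p ∈ s, x p - ∑ p ∈ s, y p) := by
  rw [Finset.sum_add_distrib, ← Finset.mul_sum, Finset.sum_sub_distrib]

lemma upA_nonneg (hx : ∀ p, 0 ≤ x p) (p : A × B) : 0 ≤ I.upA x p :=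
  Finset.sum_nonneg fun p _ => hx p

lemma upB_nonneg (hx : ∀ p, 0 ≤ x p) (p : A × B) : 0 ≤ I.upB x p :=
  Finset.sum_nonneg fun p _ => hx p

lemma upA_add_le_upA (hx : ∀ p, 0 ≤ x p) {p m : A × B} (hm : m ∈ I.E) (h1 : m.1 = p.1)
    (h2 : I.sprefA p.1 m.2 p.2) : I.upA x m + x m ≤ I.upA x p := by
  refine add_sum_le_sum hx ?_ ?_ ?_
  · simpa using fun _ => I.sprefA_irrefl _ _
  · simp [hm, h1, h2]
  · intro q hq
    simp only [Finset.mem_filter] at hq ⊢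
    obtain ⟨hq, e, r⟩ := hq
    exact ⟨hq, e.trans h1, I.sprefA_trans _ _ _ _ (h1 ▸ r) h2⟩

lemma upB_add_le_upB (hx : ∀ p, 0 ≤ x p) {p m : A × B} (hm : m ∈ I.E) (h1 : m.2 = p.2)
    (h2 : I.sprefB p.2 m.1 p.1) : I.upB x m + x m ≤ I.upB x p := by
  refine add_sum_le_sum hx ?_ ?_ ?_
  · simpa using fun _ => I.sprefB_irrefl _ _
  · simp [hm, h1, h2]
  · intro q hq
    simp only [Finset.mem_filter] at hq ⊢
    obtain ⟨hq, e, r⟩ := hq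
    exact ⟨hq, e.trans h1, I.sprefB_trans _ _ _ _ (h1 ▸ r) h2⟩

lemma upB_add_le_degB (hx : ∀ p, 0 ≤ x p) {p : A × B} (hp : p ∈ I.E) :
    I.upB x p + x p ≤ I.degB x p.2 := by
  refine add_sum_le_sum hx ?_ ?_ ?_
  · simpa using fun _ => I.sprefB_irrefl _ _
  · simp [hp]
  · intro q hq
    simp only [Finset.mem_filter] at hq ⊢
    exact ⟨hq.1, hq.2.1⟩

/-- An edge of the support at `p.2` which is not above `p` leaves room below `p`. -/
lemma upB_lt_degB (hx : ∀ p, 0 ≤ x p) {p m : A × B} (hm : m ∈ I.E) (hxm : 0 < x m)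
    (h1 : m.2 = p.2) (h2 : ¬ I.sprefB p.2 m.1 p.1) : I.upB x p < I.degB x p.2 := by
  have : I.upB x p + x m ≤ I.degB x p.2 := by
    refine add_sum_le_sum hx ?_ ?_ ?_
    · simp [h2]
    · simp [hm, h1]
    · intro q hq
      simp only [Finset.mem_filter] at hq ⊢
      exact ⟨hq.1, hq.2.1⟩
  linarith

lemma le_degA (hx : ∀ p, 0 ≤ x p) {p : A × B} (hp : p ∈ I.E) : x p ≤ I.degA x p.1 :=
  Finset.single_le_sum (fun q _ => hx q) (by simp [hp])

/-! ### Incidence vectors -/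

lemma chi_nonneg (p : A × B) : 0 ≤ chi M p := by
  unfold chi
  split_ifs <;> norm_num

lemma sum_chi_eq_zero {s : Finset (A × B)} (h : ∀ p ∈ s, p ∉ M) : ∑ p ∈ s, chi M p = 0 :=
  Finset.sum_eq_zero fun p hp => if_neg (h p hp)

lemma one_le_sum_chi {s : Finset (A × B)} {m : A × B} (hm : m ∈ M) (hs : m ∈ s) :
    1 ≤ ∑ p ∈ s, chi M p := by
  have : chi M m ≤ ∑ p ∈ s, chi M p := Finset.single_le_sum (fun q _ => chi_nonneg q) hs
  rwa [show chi M m = 1 from if_pos hm] at this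

lemma sum_chi_le_one {s : Finset (A × B)}
    (h : ∀ p ∈ s, ∀ q ∈ s, p ∈ M → q ∈ M → p = q) : ∑ p ∈ s, chi M p ≤ 1 := by
  by_cases hs : ∃ m ∈ s, m ∈ M
  · obtain ⟨m, hm, hM⟩ := hs
    have hother : ∀ q ∈ s, q ≠ m → chi M q = 0 := fun q hq hne =>
      if_neg fun hqM => hne (h q hq m hm hqM hM)
    rw [Finset.sum_eq_single_of_mem m hm hother]
    exact (if_pos hM).le
  · push Not at hs
    rw [sum_chi_eq_zero hs]
    exact zero_le_one

lemma IsMatching.sum_chi_le_one_left (hM : I.IsMatching M) {s : Finset (A × B)} {a : A}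
    (h : ∀ p ∈ s, p.1 = a) : ∑ p ∈ s, chi M p ≤ 1 :=
  sum_chi_le_one fun p hp q hq hpM hqM => hM.2.1 p hpM q hqM ((h p hp).trans (h q hq).symm)

lemma IsMatching.sum_chi_le_one_right (hM : I.IsMatching M) {s : Finset (A × B)} {b : B}
    (h : ∀ p ∈ s, p.2 = b) : ∑ p ∈ s, chi M p ≤ 1 :=
  sum_chi_le_one fun p hp q hq hpM hqM => hM.2.2 p hpM q hqM ((h p hp).trans (h q hq).symm)

lemma SuperStable.feasible_chi (hM : I.SuperStable M) : I.Feasible (chi M) := by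
  obtain ⟨hm, hs⟩ := hM
  refine ⟨fun p hp => if_neg fun h => hp (hm.1 h),
    fun a => hm.sum_chi_le_one_left (a := a) (by simp),
    fun b => hm.sum_chi_le_one_right (b := b) (by simp), ?_, chi_nonneg⟩
  intro p hp
  change 1 ≤ I.upA (chi M) p + I.upB (chi M) p + chi M p
  have hA := I.upA_nonneg (chi_nonneg (M := M)) p
  have hB := I.upB_nonneg (chi_nonneg (M := M)) p
  have h0 := chi_nonneg (M := M) p
  by_contra hlt
  refine hs p.1 p.2 ⟨hp, fun h => ?_, fun b' hb h => ?_, fun a' ha h => ?_⟩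
  · have : chi M p = 1 := if_pos h
    linarith
  · have : 1 ≤ I.upA (chi M) p := one_le_sum_chi hb (by simp [hm.1 hb, h])
    linarith
  · have : 1 ≤ I.upB (chi M) p := one_le_sum_chi ha (by simp [hm.1 ha, h])
    linarith

lemma Feasible.le_one (hx : I.Feasible x) (p : A × B) : x p ≤ 1 := by
  by_cases hp : p ∈ I.E
  · exact (le_degA hx.2.2.2.2 hp).trans (hx.2.1 p.1)
  · rw [hx.1 p hp]
    exact zero_le_one

lemma SuperStable.chi_mem_extremePoints (hM : I.SuperStable M) :
    chi M ∈ Set.extremePoints ℝ {y | I.Feasible y} := by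
  refine ⟨hM.feasible_chi, ?_⟩
  rintro y hy z hz ⟨s, t, hs, ht, hst, h⟩
  funext p
  have hp : s * y p + t * z p = chi M p := by simpa using congrFun h p
  have hy0 := hy.2.2.2.2 p
  have hz0 := hz.2.2.2.2 p
  have hy1 := hy.le_one p
  have hz1 := hz.le_one p
  by_cases hpM : p ∈ M
  · have h1 : chi M p = 1 := if_pos hpM
    rw [h1] at hp ⊢
    nlinarith
  · have h0 : chi M p = 0 := if_neg hpM
    rw [h0] at hp ⊢
    nlinarith [mul_nonneg ht.le hz0]

/-! ### The structure of feasible points -/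

lemma sum_mul_degA (x : A × B → ℝ) :
    ∑ p ∈ I.E, x p * I.degA x p.1 =
      2 * ∑ p ∈ I.E, x p * I.upA x p + ∑ p ∈ I.E, x p * x p +
      ∑ p ∈ I.E, x p * ∑ q ∈ I.E.filter (fun q => q.1 = p.1 ∧ q ≠ p ∧
        ¬ (q.1 = p.1 ∧ I.sprefA p.1 q.2 p.2) ∧ ¬ (p.1 = q.1 ∧ I.sprefA q.1 p.2 q.2)), x q := by
  have h := sum_mul_sum_filter_eq I.E x (fun q p => q.1 = p.1)
    (fun q p => q.1 = p.1 ∧ I.sprefA p.1 q.2 p.2) (fun _ => rfl) (fun _ _ h => h.symm)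
    (fun _ _ h => h.1) (by
      rintro p q ⟨h, r⟩ ⟨-, r'⟩
      rw [h] at r'
      exact I.sprefA_irrefl _ _ (I.sprefA_trans _ _ _ _ r r'))
  unfold degA upA
  convert h

lemma sum_mul_degB (x : A × B → ℝ) :
    ∑ p ∈ I.E, x p * I.degB x p.2 =
      2 * ∑ p ∈ I.E, x p * I.upB x p + ∑ p ∈ I.E, x p * x p +
      ∑ p ∈ I.E, x p * ∑ q ∈ I.E.filter (fun q => q.2 = p.2 ∧ q ≠ p ∧
        ¬ (q.2 = p.2 ∧ I.sprefB p.2 q.1 p.1) ∧ ¬ (p.2 = q.2 ∧ I.sprefB q.2 p.1 q.1)), x q := by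
  have h := sum_mul_sum_filter_eq I.E x (fun q p => q.2 = p.2)
    (fun q p => q.2 = p.2 ∧ I.sprefB p.2 q.1 p.1) (fun _ => rfl) (fun _ _ h => h.symm)
    (fun _ _ h => h.1) (by
      rintro p q ⟨h, r⟩ ⟨-, r'⟩
      rw [h] at r'
      exact I.sprefB_irrefl _ _ (I.sprefB_trans _ _ _ _ r r'))
  unfold degB upB
  convert h

/-- On the support of a feasible point the stability constraints are tight, the degrees are
one, and preferences are total. -/
lemma Feasible.support_structure (hx : I.Feasible x) {p : A × B} (hp : p ∈ I.E)
    (hxp : 0 < x p) :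
    I.upA x p + I.upB x p + x p = 1 ∧ I.degA x p.1 = 1 ∧ I.degB x p.2 = 1 ∧
    (∀ q ∈ I.E, 0 < x q → q.1 = p.1 → q ≠ p →
      I.sprefA p.1 q.2 p.2 ∨ I.sprefA p.1 p.2 q.2) ∧
    (∀ q ∈ I.E, 0 < x q → q.2 = p.2 → q ≠ p →
      I.sprefB p.2 q.1 p.1 ∨ I.sprefB p.2 p.1 q.1) := by
  obtain ⟨-, hA, hB, hL, h0⟩ := feasible_iff.1 hx
  have eA := sum_mul_degA (I := I) x
  have eB := sum_mul_degB (I := I) x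
  set cA : A × B → ℝ := fun p => ∑ q ∈ I.E.filter (fun q => q.1 = p.1 ∧ q ≠ p ∧
    ¬ (q.1 = p.1 ∧ I.sprefA p.1 q.2 p.2) ∧ ¬ (p.1 = q.1 ∧ I.sprefA q.1 p.2 q.2)), x q with hcA
  set cB : A × B → ℝ := fun p => ∑ q ∈ I.E.filter (fun q => q.2 = p.2 ∧ q ≠ p ∧
    ¬ (q.2 = p.2 ∧ I.sprefB p.2 q.1 p.1) ∧ ¬ (p.2 = q.2 ∧ I.sprefB q.2 p.1 q.1)), x q with hcB
  have hcA0 : ∀ p, 0 ≤ cA p := fun p => Finset.sum_nonneg fun q _ => h0 q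
  have hcB0 : ∀ p, 0 ≤ cB p := fun p => Finset.sum_nonneg fun q _ => h0 q
  have hsum : ∑ p ∈ I.E, x p * (2 * (I.upA x p + I.upB x p + x p - 1) +
      (1 - I.degA x p.1) + (1 - I.degB x p.2) + cA p + cB p) = 0 := by
    simp only [mul_add, mul_sub, Finset.sum_add_distrib, Finset.sum_sub_distrib,
      mul_left_comm _ (2 : ℝ), ← Finset.mul_sum]
    rw [eA, eB]
    ring
  have hterm := (Finset.sum_eq_zero_iff_of_nonneg fun q hq => mul_nonneg (h0 q) (by
    linarith [hA q.1, hB q.2, hL q hq, hcA0 q, hcB0 q])).1 hsum p hp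
  have hz := (mul_eq_zero.1 hterm).resolve_left hxp.ne'
  have h1 := hA p.1
  have h2 := hB p.2
  have h3 := hL p hp
  have h4 := hcA0 p
  have h5 := hcB0 p
  have zA : cA p = 0 := by linarith
  have zB : cB p = 0 := by linarith
  refine ⟨by linarith, by linarith, by linarith, fun q hq hxq e hne => ?_,
    fun q hq hxq e hne => ?_⟩
  · by_contra hn
    push Not at hn
    refine hxq.ne' ((Finset.sum_eq_zero_iff_of_nonneg fun q _ => h0 q).1 zA q ?_)
    simp [hq, e, hne, hn]
  · by_contra hn
    push Not at hn
    refine hxq.ne' ((Finset.sum_eq_zero_iff_of_nonneg fun q _ => h0 q).1 zB q ?_)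
    simp [hq, e, hne, hn]

/-- The edges of the support of `x` that are best for their endpoint in `A`. -/
noncomputable def topMatching (I : POInstance A B) (x : A × B → ℝ) : Finset (A × B) :=
  I.E.filter fun p => 0 < x p ∧ I.upA x p = 0

lemma mem_topMatching {p : A × B} :
    p ∈ I.topMatching x ↔ p ∈ I.E ∧ 0 < x p ∧ I.upA x p = 0 :=
  Finset.mem_filter

lemma Feasible.upB_add_eq_one (hx : I.Feasible x) {p : A × B} (hp : p ∈ I.topMatching x) :
    I.upB x p + x p = 1 := by
  obtain ⟨hE, h0, hup⟩ := mem_topMatching.1 hp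
  linarith [(hx.support_structure hE h0).1]

lemma Feasible.isMatching_topMatching (hx : I.Feasible x) :
    I.IsMatching (I.topMatching x) := by
  have h0 := hx.2.2.2.2
  refine ⟨Finset.filter_subset _ _, fun p hp q hq e => ?_, fun p hp q hq e => ?_⟩
  · obtain ⟨hpE, hxp, hup⟩ := mem_topMatching.1 hp
    obtain ⟨hqE, hxq, huq⟩ := mem_topMatching.1 hq
    by_contra hne
    rcases (hx.support_structure hqE hxq).2.2.2.1 p hpE hxp e hne with h | h
    · linarith [upA_add_le_upA h0 hpE e h, upA_nonneg (I := I) h0 p]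
    · linarith [upA_add_le_upA h0 hqE e.symm (e ▸ h), upA_nonneg (I := I) h0 q]
  · obtain ⟨hpE, hxp, hup⟩ := mem_topMatching.1 hp
    obtain ⟨hqE, hxq, huq⟩ := mem_topMatching.1 hq
    have hp1 := hx.upB_add_eq_one hp
    have hq1 := hx.upB_add_eq_one hq
    by_contra hne
    rcases (hx.support_structure hqE hxq).2.2.2.2 p hpE hxp e hne with h | h
    · linarith [upB_add_le_upB h0 hpE e h]
    · linarith [upB_add_le_upB h0 hqE e.symm (e ▸ h)]

lemma Feasible.exists_mem_topMatching_left (hx : I.Feasible x) {p : A × B} (hp : p ∈ I.E)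
    (hxp : 0 < x p) :
    ∃ m ∈ I.topMatching x, m.1 = p.1 ∧ (m = p ∨ I.sprefA p.1 m.2 p.2) := by
  have h0 := hx.2.2.2.2
  obtain ⟨m, hm, hmin⟩ := Finset.exists_min_image
    (I.E.filter fun q => 0 < x q ∧ q.1 = p.1) (I.upA x) ⟨p, by simp [hp, hxp]⟩
  simp only [Finset.mem_filter] at hm hmin
  obtain ⟨hmE, hxm, hm1⟩ := hm
  refine ⟨m, mem_topMatching.2 ⟨hmE, hxm, ?_⟩, hm1, ?_⟩
  · refine Finset.sum_eq_zero fun q hq => ?_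
    simp only [Finset.mem_filter] at hq
    obtain ⟨hqE, e, r⟩ := hq
    by_contra hne
    have hq0 : 0 < x q := lt_of_le_of_ne (h0 q) (Ne.symm hne)
    linarith [hmin q ⟨hqE, hq0, e.trans hm1⟩, upA_add_le_upA h0 hqE e r]
  · by_contra! hcon
    rcases (hx.support_structure hp hxp).2.2.2.1 m hmE hxm hm1 hcon.1 with h | h
    · exact hcon.2 h
    · linarith [hmin p ⟨hp, hxp, rfl⟩, upA_add_le_upA h0 hp hm1.symm (hm1 ▸ h)]

lemma Feasible.exists_mem_topMatching_right (hx : I.Feasible x) {p : A × B} (hp : p ∈ I.E)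
    (hxp : 0 < x p) : ∃ m ∈ I.topMatching x, m.2 = p.2 := by
  have h0 := hx.2.2.2.2
  obtain ⟨m, hm, hmax⟩ := Finset.exists_max_image
    (I.E.filter fun q => 0 < x q ∧ q.2 = p.2) (I.upB x) ⟨p, by simp [hp, hxp]⟩
  simp only [Finset.mem_filter] at hm hmax
  obtain ⟨hmE, hxm, hm1⟩ := hm
  obtain ⟨htight, -, hdeg, -, htot⟩ := hx.support_structure hmE hxm
  refine ⟨m, mem_topMatching.2 ⟨hmE, hxm, ?_⟩, hm1⟩
  have hle : I.degB x m.2 = x m + I.upB x m := by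
    unfold degB upB
    rw [← Finset.sum_insert (by simpa using fun _ => I.sprefB_irrefl _ _)]
    refine (Finset.sum_subset ?_ fun q hq hq' => ?_).symm
    · intro q hq
      simp only [Finset.mem_insert, Finset.mem_filter] at hq ⊢
      rcases hq with rfl | hq
      · exact ⟨hmE, rfl⟩
      · exact ⟨hq.1, hq.2.1⟩
    · simp only [Finset.mem_insert, Finset.mem_filter, not_or] at hq hq'
      by_contra hne
      have hq0 : 0 < x q := lt_of_le_of_ne (h0 q) (Ne.symm hne)
      rcases htot q hq.1 hq0 hq.2 hq'.1 with h | h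
      · exact hq'.2 ⟨hq.1, hq.2, h⟩
      · linarith [hmax q ⟨hq.1, hq0, hq.2.trans hm1⟩,
          upB_add_le_upB h0 hmE hq.2.symm (hq.2 ▸ h)]
  linarith

lemma Feasible.superStable_topMatching (hx : I.Feasible x) :
    I.SuperStable (I.topMatching x) := by
  obtain ⟨-, -, hB, hL, h0⟩ := feasible_iff.1 hx
  refine ⟨hx.isMatching_topMatching, ?_⟩
  rintro a b ⟨hE, hM, hna, hnb⟩
  have hupA : I.upA x (a, b) = 0 := by
    refine Finset.sum_eq_zero fun q hq => ?_
    simp only [Finset.mem_filter] at hq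
    obtain ⟨hqE, e, r⟩ := hq
    by_contra hne
    have hq0 : 0 < x q := lt_of_le_of_ne (h0 q) (Ne.symm hne)
    obtain ⟨⟨a', b'⟩, hm, hm1, hm2⟩ := hx.exists_mem_topMatching_left hqE hq0
    obtain rfl : a' = a := hm1.trans e
    refine hna b' hm ?_
    rcases hm2 with rfl | hm2
    · exact r
    · rw [e] at hm2
      exact I.sprefA_trans _ _ _ _ hm2 r
  have hx0 : x (a, b) = 0 := by
    by_contra hne
    exact hM (mem_topMatching.2 ⟨hE, lt_of_le_of_ne (h0 _) (Ne.symm hne), hupA⟩)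
  have hupB : 1 ≤ I.upB x (a, b) := by linarith [hL _ hE]
  obtain ⟨q, hq, hq0⟩ := Finset.exists_ne_zero_of_sum_ne_zero
    (show I.upB x (a, b) ≠ 0 by linarith)
  simp only [Finset.mem_filter] at hq
  obtain ⟨⟨a', b'⟩, hm, hm2⟩ := hx.exists_mem_topMatching_right hq.1
    (lt_of_le_of_ne (h0 q) (Ne.symm hq0))
  obtain rfl : b' = b := hm2.trans hq.2.1
  obtain ⟨hmE, hxm, -⟩ := mem_topMatching.1 hm
  have hlt := upB_lt_degB (p := (a, b')) h0 hmE hxm rfl (hnb a' hm)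
  have hle := hB b'
  linarith

/-- Stability constraints tight at `x` are tight at its top matching. -/
lemma Feasible.chi_topMatching_le_one (hx : I.Feasible x) {p : A × B}
    (ht : I.upA x p + I.upB x p + x p = 1) :
    I.upA (chi (I.topMatching x)) p + I.upB (chi (I.topMatching x)) p +
      chi (I.topMatching x) p ≤ 1 := by
  have h0 := hx.2.2.2.2
  have hm := hx.isMatching_topMatching
  have leA : I.upA (chi (I.topMatching x)) p ≤ 1 :=
    hm.sum_chi_le_one_left (a := p.1) (by simp +contextual)
  have leB : I.upB (chi (I.topMatching x)) p ≤ 1 :=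
    hm.sum_chi_le_one_right (b := p.2) (by simp +contextual)
  have zA : (∀ m ∈ I.topMatching x, m.1 = p.1 → ¬ I.sprefA p.1 m.2 p.2) →
      I.upA (chi (I.topMatching x)) p = 0 := fun h => sum_chi_eq_zero fun q hq hqM => by
    simp only [Finset.mem_filter] at hq
    exact h q hqM hq.2.1 hq.2.2
  have zB : (∀ m ∈ I.topMatching x, m.2 = p.2 → ¬ I.sprefB p.2 m.1 p.1) →
      I.upB (chi (I.topMatching x)) p = 0 := fun h => sum_chi_eq_zero fun q hq hqM => by
    simp only [Finset.mem_filter] at hq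
    exact h q hqM hq.2.1 hq.2.2
  by_cases hp : p ∈ I.topMatching x
  · have h1 : chi (I.topMatching x) p = 1 := if_pos hp
    rw [h1, zA, zB]
    · norm_num
    · intro m hmM e r
      rw [hm.2.2 m hmM p hp e] at r
      exact I.sprefB_irrefl _ _ r
    · intro m hmM e r
      rw [hm.2.1 m hmM p hp e] at r
      exact I.sprefA_irrefl _ _ r
  · have h1 : chi (I.topMatching x) p = 0 := if_neg hp
    by_cases hA : ∃ m ∈ I.topMatching x, m.1 = p.1 ∧ I.sprefA p.1 m.2 p.2
    · obtain ⟨m, hmM, e, r⟩ := hA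
      obtain ⟨hmE, hxm, -⟩ := mem_topMatching.1 hmM
      rw [h1, zB]
      · linarith
      · intro n hn e' r'
        linarith [upA_add_le_upA h0 hmE e r, upA_nonneg (I := I) h0 m, h0 p,
          hx.upB_add_eq_one hn, upB_add_le_upB h0 (hm.1 hn) e' r']
    · push Not at hA
      rw [h1, zA hA]
      linarith

/-- A feasible point can be pushed away from its top matching. -/
lemma Feasible.exists_feasible_add_mul_sub (hx : I.Feasible x) :
    ∃ δ > 0, I.Feasible fun p => x p + δ * (x p - chi (I.topMatching x) p) := by
  obtain ⟨hE, hA, hB, hL, h0⟩ := feasible_iff.1 hx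
  have hm := hx.isMatching_topMatching
  set c := chi (I.topMatching x)
  have supp : ∀ s : Finset (A × B), ∑ q ∈ s, x q = 1 → ∃ q ∈ s, 0 < x q := fun s hs => by
    obtain ⟨q, hq, hne⟩ := Finset.exists_ne_zero_of_sum_ne_zero
      (show ∑ q ∈ s, x q ≠ 0 by rw [hs]; exact one_ne_zero)
    exact ⟨q, hq, lt_of_le_of_ne (h0 q) (Ne.symm hne)⟩
  have key : ∀ᶠ δ in nhdsWithin (0 : ℝ) (Set.Ioi 0), ∀ p ∈ I.E,
      -1 ≤ -I.degA x p.1 + δ * (-I.degA x p.1 - -I.degA c p.1) ∧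
      -1 ≤ -I.degB x p.2 + δ * (-I.degB x p.2 - -I.degB c p.2) ∧
      1 ≤ (I.upA x p + I.upB x p + x p) + δ * ((I.upA x p + I.upB x p + x p) -
        (I.upA c p + I.upB c p + c p)) ∧
      0 ≤ x p + δ * (x p - c p) := by
    rw [Filter.eventually_all_finset]
    intro p hp
    refine (eventually_le_add_mul_sub (neg_le_neg (hA p.1)) fun h => ?_).and
      ((eventually_le_add_mul_sub (neg_le_neg (hB p.2)) fun h => ?_).and
      ((eventually_le_add_mul_sub (hL p hp) fun h => hx.chi_topMatching_le_one h).and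
      (eventually_le_add_mul_sub (h0 p) fun h => (if_neg fun hM => ?_ : c p = 0).le)))
    · obtain ⟨q, hq, hq0⟩ := supp _ (neg_inj.1 h)
      simp only [Finset.mem_filter] at hq
      obtain ⟨m, hmM, e, -⟩ := hx.exists_mem_topMatching_left hq.1 hq0
      exact neg_le_neg (one_le_sum_chi hmM (by simp [hm.1 hmM, e, hq.2]))
    · obtain ⟨q, hq, hq0⟩ := supp _ (neg_inj.1 h)
      simp only [Finset.mem_filter] at hq
      obtain ⟨m, hmM, e⟩ := hx.exists_mem_topMatching_right hq.1 hq0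
      exact neg_le_neg (one_le_sum_chi hmM (by simp [hm.1 hmM, e, hq.2]))
    · exact (mem_topMatching.1 hM).2.1.ne' h
  obtain ⟨δ, hδ, hpos⟩ := (key.and self_mem_nhdsWithin).exists
  refine ⟨δ, hpos, fun p hp => ?_, fun a => ?_, fun b => ?_, fun p hp => ?_, fun p => ?_⟩
  · simp [hE p hp, show c p = 0 from if_neg fun h => hp (hm.1 h)]
  · rcases (I.E.filter fun p => p.1 = a).eq_empty_or_nonempty with h | ⟨p, hp⟩
    · rw [h, Finset.sum_empty]
      exact zero_le_one
    · simp only [Finset.mem_filter] at hp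
      obtain ⟨hp, rfl⟩ := hp
      have := (hδ p hp).1
      rw [sum_add_mul_sub]
      change I.degA x p.1 + δ * (I.degA x p.1 - I.degA c p.1) ≤ 1
      linarith
  · rcases (I.E.filter fun p => p.2 = b).eq_empty_or_nonempty with h | ⟨p, hp⟩
    · rw [h, Finset.sum_empty]
      exact zero_le_one
    · simp only [Finset.mem_filter] at hp
      obtain ⟨hp, rfl⟩ := hp
      have := (hδ p hp).2.1
      rw [sum_add_mul_sub]
      change I.degB x p.2 + δ * (I.degB x p.2 - I.degB c p.2) ≤ 1
      linarith
  · have := (hδ p hp).2.2.1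
    rw [sum_add_mul_sub, sum_add_mul_sub]
    change I.upA x p + δ * (I.upA x p - I.upA c p) +
      (I.upB x p + δ * (I.upB x p - I.upB c p)) + (x p + δ * (x p - c p)) ≥ 1
    linarith
  · by_cases hp : p ∈ I.E
    · exact (hδ p hp).2.2.2
    · simp [hE p hp, show c p = 0 from if_neg fun h => hp (hm.1 h)]

end POInstance

/-- With partial order preference lists, the super-stable matching polytope is still
described by the linear system (a)–(c): `x ∈ ℝ^E` is an extreme point of the polytope
iff `x` is the incidence vector of a super-stable matching of `G`. -/
theorem po_super_stable_polytope_integral {A B : Type*} (I : POInstance A B) :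
    ∀ x : A × B → ℝ,
      x ∈ Set.extremePoints ℝ {y | I.Feasible y} ↔
        ∃ M, I.SuperStable M ∧ x = POInstance.chi M := by
  intro x
  refine ⟨fun hx => ?_, ?_⟩
  · have hfeas : I.Feasible x := hx.1
    refine ⟨I.topMatching x, hfeas.superStable_topMatching, ?_⟩
    obtain ⟨δ, hδ, hy⟩ := hfeas.exists_feasible_add_mul_sub
    have hpos : 0 < 1 + δ := by linarith
    refine (hx.2 hfeas.superStable_topMatching.feasible_chi hy
      ⟨δ / (1 + δ), 1 / (1 + δ), by positivity, by positivity, by field_simp; ring, ?_⟩).symm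
    funext p
    simp only [Pi.add_apply, Pi.smul_apply, smul_eq_mul]
    field_simp
    ring
  · rintro ⟨M, hM, rfl⟩
    exact hM.chi_mem_extremePoints
end

section
/- Let x ∈ ℝ^E be a feasible solution of the strongly stable matching linear system (a)–(d). For each vertex u and each vertex v that is a maximal element (with respect to ⪰_u) of the support {i ∈ N(u) : x_{u,i} > 0}, the following hold: u is a minimal element (with respect to ⪰_v) of {j ∈ N(v) : x_{j,v} > 0}; ∑_{j ∈ N(v)} x_{j,v} = 1; and ∑_{k : k =_u v} x_{u,k} ≥ ∑_{k : k =_v u} x_{k,v}. -/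
open scoped Classical

/-- An instance of the super-stable matching problem: a finite bipartite graph with
men `A`, women `B`, edge set `E`, and for each vertex a total preorder (preference
list with ties) on its neighbors. `prefA a b b'` means `b ⪰_a b'`. -/
structure SMInstance (A B : Type*) where
  E : Finset (A × B)
  prefA : A → B → B → Prop
  prefB : B → A → A → Prop
  prefA_refl : ∀ a b, (a, b) ∈ E → prefA a b b
  prefA_trans : ∀ a b₁ b₂ b₃, prefA a b₁ b₂ → prefA a b₂ b₃ → prefA a b₁ b₃
  prefA_total : ∀ a b₁ b₂, (a, b₁) ∈ E → (a, b₂) ∈ E → prefA a b₁ b₂ ∨ prefA a b₂ b₁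
  prefB_refl : ∀ b a, (a, b) ∈ E → prefB b a a
  prefB_trans : ∀ b a₁ a₂ a₃, prefB b a₁ a₂ → prefB b a₂ a₃ → prefB b a₁ a₃
  prefB_total : ∀ b a₁ a₂, (a₁, b) ∈ E → (a₂, b) ∈ E → prefB b a₁ a₂ ∨ prefB b a₂ a₁

namespace SMInstance

variable {A B : Type*}

/-- A matching: a set of pairwise disjoint edges of the graph. -/
def IsMatching (I : SMInstance A B) (M : Finset (A × B)) : Prop :=
  M ⊆ I.E ∧
  (∀ p ∈ M, ∀ q ∈ M, p.1 = q.1 → p = q) ∧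
  (∀ p ∈ M, ∀ q ∈ M, p.2 = q.2 → p = q)

/-- `(a,b)` is a blocking edge for `M`: it is an edge outside `M`, `a` is unmatched
or weakly prefers `b` to its partner, and `b` is unmatched or weakly prefers `a` to
its partner. -/
def Blocks (I : SMInstance A B) (M : Finset (A × B)) (a : A) (b : B) : Prop :=
  (a, b) ∈ I.E ∧ (a, b) ∉ M ∧
  (∀ b', (a, b') ∈ M → I.prefA a b b') ∧
  (∀ a', (a', b) ∈ M → I.prefB b a a')

/-- A super-stable matching: a matching with no blocking edge. -/
def SuperStable (I : SMInstance A B) (M : Finset (A × B)) : Prop :=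
  I.IsMatching M ∧ ∀ a b, ¬ I.Blocks M a b

/-- `M` dominates `N`: every man matched in `N` is matched in `M` to a partner he
weakly prefers. -/
def Dominates (I : SMInstance A B) (M N : Finset (A × B)) : Prop :=
  ∀ a b, (a, b) ∈ N → ∃ b', (a, b') ∈ M ∧ I.prefA a b' b

/-- Strict preference `b ≻_a b'`. -/
def SPrefA (I : SMInstance A B) (a : A) (b b' : B) : Prop :=
  I.prefA a b b' ∧ ¬ I.prefA a b' b

/-- Strict preference `a ≻_b a'`. -/
def SPrefB (I : SMInstance A B) (b : B) (a a' : A) : Prop :=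
  I.prefB b a a' ∧ ¬ I.prefB b a' a

end SMInstance

namespace SMInstance

variable {A B : Type*}

/-- The incidence vector `χ^M` of a set of edges `M`. -/
noncomputable def chi (M : Finset (A × B)) : A × B → ℝ :=
  fun p => if p ∈ M then 1 else 0

/-- `∑_{i ∈ N(a)} x_{a,i}`, the sum of `x` over the edges incident to the man `a`. -/
noncomputable def rowSum (I : SMInstance A B) (x : A × B → ℝ) (a : A) : ℝ :=
  ∑ p ∈ I.E.filter (fun p => p.1 = a), x p

/-- `∑_{j ∈ N(b)} x_{j,b}`, the sum of `x` over the edges incident to the woman `b`. -/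
noncomputable def colSum (I : SMInstance A B) (x : A × B → ℝ) (b : B) : ℝ :=
  ∑ p ∈ I.E.filter (fun p => p.2 = b), x p

/-- Constraint (b) of the super-stable matching linear system at edge `p = (u,v)`:
`∑_{i ≻_u v} x_{u,i} + ∑_{j ≻_v u} x_{j,v} + x_{u,v} ≥ 1`. -/
def StabIneq (I : SMInstance A B) (x : A × B → ℝ) (p : A × B) : Prop :=
  (∑ q ∈ I.E.filter (fun q => q.1 = p.1 ∧ I.SPrefA p.1 q.2 p.2), x q) +
  (∑ q ∈ I.E.filter (fun q => q.2 = p.2 ∧ I.SPrefB p.2 q.1 p.1), x q) +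
  x p ≥ 1

/-- `x ∈ ℝ^E` is a feasible solution of the super-stable matching linear system
(a)–(c). -/
def Feasible (I : SMInstance A B) (x : A × B → ℝ) : Prop :=
  (∀ p, p ∉ I.E → x p = 0) ∧
  (∀ a : A, I.rowSum x a ≤ 1) ∧
  (∀ b : B, I.colSum x b ≤ 1) ∧
  (∀ p ∈ I.E, I.StabIneq x p) ∧
  (∀ p, 0 ≤ x p)

end SMInstance

namespace SMInstance

variable {A B : Type*}

/-- Indifference `b =_a b'`. -/
def EqA (I : SMInstance A B) (a : A) (b b' : B) : Prop :=
  I.prefA a b b' ∧ I.prefA a b' b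

/-- Indifference `a =_b a'`. -/
def EqB (I : SMInstance A B) (b : B) (a a' : A) : Prop :=
  I.prefB b a a' ∧ I.prefB b a' a

/-- `(a,b)` is a blocking edge for strong stability: one endpoint would become
strictly better off and the other not worse off. -/
def StrongBlocks (I : SMInstance A B) (M : Finset (A × B)) (a : A) (b : B) : Prop :=
  (a, b) ∈ I.E ∧ (a, b) ∉ M ∧
  (((∀ b', (a, b') ∈ M → I.SPrefA a b b') ∧ (∀ a', (a', b) ∈ M → I.prefB b a a')) ∨
   ((∀ b', (a, b') ∈ M → I.prefA a b b') ∧ (∀ a', (a', b) ∈ M → I.SPrefB b a a')))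

/-- A strongly stable matching: a matching with no blocking edge for strong
stability. -/
def StronglyStable (I : SMInstance A B) (M : Finset (A × B)) : Prop :=
  I.IsMatching M ∧ ∀ a b, ¬ I.StrongBlocks M a b

/-- Constraint (b) of the strongly stable matching linear system at `p = (u,v)`:
`∑_{i ≻_u v} x_{u,i} + ∑_{j ≻_v u} x_{j,v} + ∑_{k =_u v} x_{u,k} ≥ 1` (the sum over
`k =_u v` includes `k = v`). -/
def StrongIneqB (I : SMInstance A B) (x : A × B → ℝ) (p : A × B) : Prop :=
  (∑ q ∈ I.E.filter (fun q => q.1 = p.1 ∧ I.SPrefA p.1 q.2 p.2), x q) +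
  (∑ q ∈ I.E.filter (fun q => q.2 = p.2 ∧ I.SPrefB p.2 q.1 p.1), x q) +
  (∑ q ∈ I.E.filter (fun q => q.1 = p.1 ∧ I.EqA p.1 q.2 p.2), x q) ≥ 1

/-- Constraint (c) of the strongly stable matching linear system at `p = (u,v)`:
`∑_{i ≻_u v} x_{u,i} + ∑_{j ≻_v u} x_{j,v} + ∑_{k =_v u} x_{k,v} ≥ 1` (the sum over
`k =_v u` includes `k = u`). -/
def StrongIneqC (I : SMInstance A B) (x : A × B → ℝ) (p : A × B) : Prop :=
  (∑ q ∈ I.E.filter (fun q => q.1 = p.1 ∧ I.SPrefA p.1 q.2 p.2), x q) +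
  (∑ q ∈ I.E.filter (fun q => q.2 = p.2 ∧ I.SPrefB p.2 q.1 p.1), x q) +
  (∑ q ∈ I.E.filter (fun q => q.2 = p.2 ∧ I.EqB p.2 q.1 p.1), x q) ≥ 1

/-- `x ∈ ℝ^E` is a feasible solution of the strongly stable matching linear system
(a)–(d). -/
def StrongFeasible (I : SMInstance A B) (x : A × B → ℝ) : Prop :=
  (∀ p, p ∉ I.E → x p = 0) ∧
  (∀ a : A, I.rowSum x a ≤ 1) ∧
  (∀ b : B, I.colSum x b ≤ 1) ∧
  (∀ p ∈ I.E, I.StrongIneqB x p) ∧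
  (∀ p ∈ I.E, I.StrongIneqC x p) ∧
  (∀ p, 0 ≤ x p)

end SMInstance

/-- If a nonnegative function has sum at most `1` on `s`, but sum at least `1` on two disjoint
parts of `s`, then both sums equal `1` and its support is contained in the two parts. -/
theorem Finset.sum_eq_one_of_one_le_sum_filter_add {ι : Type*} (s : Finset ι) (x : ι → ℝ)
    (P Q : ι → Prop) (hx : ∀ i, 0 ≤ x i) (hPQ : ∀ i, P i → ¬ Q i) (hs : ∑ i ∈ s, x i ≤ 1)
    (h : 1 ≤ ∑ i ∈ s.filter P, x i + ∑ i ∈ s.filter Q, x i) :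
    ∑ i ∈ s, x i = 1 ∧ ∑ i ∈ s.filter P, x i + ∑ i ∈ s.filter Q, x i = 1 ∧
      ∀ i ∈ s, 0 < x i → P i ∨ Q i := by
  have hdisj : Disjoint (s.filter P) (s.filter Q) :=
    Finset.disjoint_filter.mpr fun i _ => hPQ i
  rw [← Finset.sum_union hdisj, ← Finset.filter_or] at h ⊢
  have hsplit := Finset.sum_filter_add_sum_filter_not s (fun i => P i ∨ Q i) x
  have hnonneg : 0 ≤ ∑ i ∈ s.filter (fun i => ¬ (P i ∨ Q i)), x i :=
    Finset.sum_nonneg fun i _ => hx i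
  refine ⟨by linarith, by linarith, fun i hi hpos => ?_⟩
  by_contra hPQi
  have := Finset.single_le_sum (f := x) (s := s.filter (fun i => ¬ (P i ∨ Q i)))
    (fun j _ => hx j) (Finset.mem_filter.mpr ⟨hi, hPQi⟩)
  linarith

/-- For a feasible solution `x` of the strongly stable matching linear system and any
vertex `u` (of either color class), if `v` is a maximal element (w.r.t. `⪰_u`) of the
support `{i ∈ N(u) : x_{u,i} > 0}`, then `u` is a minimal element (w.r.t. `⪰_v`) of
`{j ∈ N(v) : x_{j,v} > 0}`, `∑_{j ∈ N(v)} x_{j,v} = 1`, and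
`∑_{k =_u v} x_{u,k} ≥ ∑_{k =_v u} x_{k,v}`. -/
theorem strong_feasible_maximal_support {A B : Type*} (I : SMInstance A B)
    (x : A × B → ℝ) (hx : I.StrongFeasible x) :
    (∀ (u : A) (v : B), (u, v) ∈ I.E → 0 < x (u, v) →
      (∀ i, (u, i) ∈ I.E → 0 < x (u, i) → ¬ I.SPrefA u i v) →
      (∀ j, (j, v) ∈ I.E → 0 < x (j, v) → ¬ I.SPrefB v u j) ∧
      I.colSum x v = 1 ∧
      (∑ q ∈ I.E.filter (fun q => q.1 = u ∧ I.EqA u q.2 v), x q) ≥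
        (∑ q ∈ I.E.filter (fun q => q.2 = v ∧ I.EqB v q.1 u), x q)) ∧
    (∀ (u : B) (v : A), (v, u) ∈ I.E → 0 < x (v, u) →
      (∀ i, (i, u) ∈ I.E → 0 < x (i, u) → ¬ I.SPrefB u i v) →
      (∀ j, (v, j) ∈ I.E → 0 < x (v, j) → ¬ I.SPrefA v u j) ∧
      I.rowSum x v = 1 ∧
      (∑ q ∈ I.E.filter (fun q => q.2 = u ∧ I.EqB u q.1 v), x q) ≥
        (∑ q ∈ I.E.filter (fun q => q.1 = v ∧ I.EqA v q.2 u), x q)) := by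
  obtain ⟨-, hrow, hcol, hB, hC, hpos⟩ := hx
  constructor
  · intro u v huv _ hmax
    have hzero : ∑ q ∈ I.E.filter (fun q => q.1 = u ∧ I.SPrefA u q.2 v), x q = 0 := by
      refine Finset.sum_eq_zero ?_
      rintro ⟨a, b⟩ hq
      obtain ⟨hE, rfl, hlt⟩ := Finset.mem_filter.mp hq
      exact le_antisymm (not_lt.mp fun h => hmax b hE h hlt) (hpos _)
    have hb := hB _ huv
    have hc := hC _ huv
    simp only [SMInstance.StrongIneqB, SMInstance.StrongIneqC, hzero, zero_add] at hb hc
    obtain ⟨h1, h2, h3⟩ := Finset.sum_eq_one_of_one_le_sum_filter_add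
      (I.E.filter (fun q : A × B => q.2 = v)) x (fun q => I.SPrefB v q.1 u) (fun q => I.EqB v q.1 u)
      hpos (fun q h h' => h.2 h'.2) (hcol v) (by simpa only [Finset.filter_filter] using hc)
    simp only [Finset.filter_filter] at h2
    refine ⟨fun j hj hxj hlt => ?_, h1, by linarith⟩
    rcases h3 (j, v) (Finset.mem_filter.mpr ⟨hj, rfl⟩) hxj with h | h
    · exact hlt.2 h.1
    · exact hlt.2 h.1
  · intro u v huv _ hmax
    have hzero : ∑ q ∈ I.E.filter (fun q => q.2 = u ∧ I.SPrefB u q.1 v), x q = 0 := by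
      refine Finset.sum_eq_zero ?_
      rintro ⟨a, b⟩ hq
      obtain ⟨hE, rfl, hlt⟩ := Finset.mem_filter.mp hq
      exact le_antisymm (not_lt.mp fun h => hmax a hE h hlt) (hpos _)
    have hb := hB _ huv
    have hc := hC _ huv
    simp only [SMInstance.StrongIneqB, SMInstance.StrongIneqC, hzero, add_zero] at hb hc
    obtain ⟨h1, h2, h3⟩ := Finset.sum_eq_one_of_one_le_sum_filter_add
      (I.E.filter (fun q : A × B => q.1 = v)) x (fun q => I.SPrefA v q.2 u) (fun q => I.EqA v q.2 u)
      hpos (fun q h h' => h.2 h'.2) (hrow v) (by simpa only [Finset.filter_filter] using hb)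
    simp only [Finset.filter_filter] at h2
    refine ⟨fun j hj hxj hlt => ?_, h1, by linarith⟩
    rcases h3 (v, j) (Finset.mem_filter.mpr ⟨hj, rfl⟩) hxj with h | h
    · exact hlt.2 h.1
    · exact hlt.2 h.1
end

section
/- Let x ∈ ℝ^E be a feasible solution of the strongly stable matching linear system (a)–(d), let V⁺ be the set of vertices covered by the support E⁺ = {(u,v) : x_{u,v} > 0}, and let E*(x) = {(u,v) : u ∈ U ∩ V⁺ and v is a maximal element with respect to ⪰_u of {i : x_{u,i} > 0}}. Then the bipartite graph induced by E*(x) contains a matching that saturates every vertex of U ∩ V⁺. -/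
open scoped Classical

/-- Weighted Hall condition: if the edges of a finite bipartite graph `F` carry positive weights
such that the total weight at the right endpoint of each edge is at most the total weight at its
left endpoint, then `F` contains a matching saturating every left vertex of `F`. -/
theorem exists_saturating_matching_of_sum_le_sum {A B : Type*} (F : Finset (A × B))
    (x : A × B → ℝ) (hpos : ∀ p ∈ F, 0 < x p)
    (h : ∀ p ∈ F, ∑ q ∈ F.filter (fun q => q.2 = p.2), x q ≤
      ∑ q ∈ F.filter (fun q => q.1 = p.1), x q) :
    ∃ M ⊆ F, (∀ p ∈ M, ∀ q ∈ M, p.1 = q.1 → p = q) ∧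
      (∀ p ∈ M, ∀ q ∈ M, p.2 = q.2 → p = q) ∧ ∀ p ∈ F, ∃ b, (p.1, b) ∈ M := by
  let r : A → ℝ := fun a => ∑ q ∈ F.filter (fun q => q.1 = a), x q
  let c : B → ℝ := fun b => ∑ q ∈ F.filter (fun q => q.2 = b), x q
  have hc : ∀ p ∈ F, 0 < c p.2 := fun p hp =>
    Finset.sum_pos (fun q hq => hpos q (Finset.mem_filter.1 hq).1)
      ⟨p, Finset.mem_filter.2 ⟨hp, rfl⟩⟩
  have hcr : ∀ p ∈ F, c p.2 ≤ r p.1 := h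
  let t : {a // a ∈ F.image Prod.fst} → Finset B :=
    fun a => (F.filter (fun q => q.1 = a.1)).image Prod.snd
  have hall : ∀ S : Finset {a // a ∈ F.image Prod.fst}, S.card ≤ (S.biUnion t).card := by
    intro S
    let G := F.filter (fun q => q.1 ∈ S.map (Function.Embedding.subtype _))
    have hGF : ∀ p ∈ G, p ∈ F := fun p hp => (Finset.mem_filter.1 hp).1
    have hrow : (S.card : ℝ) = ∑ p ∈ G, x p / r p.1 := by
      rw [← Finset.sum_fiberwise_of_maps_to (s := G) (g := Prod.fst)
        (fun p hp => (Finset.mem_filter.1 hp).2), Finset.sum_map]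
      rw [Finset.card_eq_sum_ones, Nat.cast_sum]
      refine Finset.sum_congr rfl fun a ha => ?_
      have hfib : G.filter (fun q => q.1 = a.1) = F.filter (fun q => q.1 = a.1) := by
        ext q
        simp only [G, Finset.mem_filter]
        refine ⟨fun hq => ⟨hq.1.1, hq.2⟩, fun hq => ⟨⟨hq.1, ?_⟩, hq.2⟩⟩
        rw [hq.2]
        exact Finset.mem_map_of_mem _ ha
      obtain ⟨p, hp, hpa⟩ := Finset.mem_image.1 a.2
      have hr : r a.1 ≠ 0 := by
        rw [← hpa]
        exact ((hc p hp).trans_le (hcr p hp)).ne'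
      have hsum : ∑ q ∈ G.filter (fun q => q.1 = a.1), x q / r q.1 = 1 := by
        rw [hfib, Finset.sum_congr rfl (g := fun q => x q / r a.1)
          (fun q hq => by rw [(Finset.mem_filter.1 hq).2]), ← Finset.sum_div]
        exact div_self hr
      rw [Nat.cast_one]
      exact hsum.symm
    have hle : ∑ p ∈ G, x p / r p.1 ≤ ∑ p ∈ G, x p / c p.2 := Finset.sum_le_sum fun p hp =>
      div_le_div_of_nonneg_left (hpos p (hGF p hp)).le (hc p (hGF p hp)) (hcr p (hGF p hp))
    have hmaps : ∀ p ∈ G, p.2 ∈ S.biUnion t := by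
      intro p hp
      obtain ⟨hpF, hpS⟩ := Finset.mem_filter.1 hp
      obtain ⟨a, ha, hap⟩ := Finset.mem_map.1 hpS
      exact Finset.mem_biUnion.2 ⟨a, ha,
        Finset.mem_image_of_mem _ (Finset.mem_filter.2 ⟨hpF, hap.symm⟩)⟩
    have hcol : ∑ p ∈ G, x p / c p.2 ≤ ((S.biUnion t).card : ℝ) := by
      rw [← Finset.sum_fiberwise_of_maps_to hmaps, Finset.card_eq_sum_ones, Nat.cast_sum]
      refine Finset.sum_le_sum fun b _ => ?_
      rw [Finset.sum_congr rfl (g := fun q => x q / c b)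
        (fun q hq => by rw [(Finset.mem_filter.1 hq).2]), ← Finset.sum_div, Nat.cast_one]
      refine div_le_one_of_le₀ ?_ (Finset.sum_nonneg fun q hq =>
        (hpos q (Finset.mem_filter.1 hq).1).le)
      exact Finset.sum_le_sum_of_subset_of_nonneg
        (Finset.filter_subset_filter _ (Finset.filter_subset _ _))
        fun q hq _ => (hpos q (Finset.mem_filter.1 hq).1).le
    exact_mod_cast hrow.le.trans (hle.trans hcol)
  obtain ⟨f, hf, hft⟩ := (Finset.all_card_le_biUnion_card_iff_exists_injective t).1 hall
  refine ⟨F.filter (fun p => ∃ h, f ⟨p.1, h⟩ = p.2), Finset.filter_subset _ _, ?_, ?_, ?_⟩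
  · intro p hp q hq hpq
    obtain ⟨-, h₁, hp⟩ := Finset.mem_filter.1 hp
    obtain ⟨-, h₂, hq⟩ := Finset.mem_filter.1 hq
    refine Prod.ext hpq ?_
    rw [← hp, ← hq]
    simp only [hpq]
  · intro p hp q hq hpq
    obtain ⟨-, h₁, hp⟩ := Finset.mem_filter.1 hp
    obtain ⟨-, h₂, hq⟩ := Finset.mem_filter.1 hq
    refine Prod.ext ?_ hpq
    rw [← hp, ← hq] at hpq
    exact congrArg Subtype.val (hf hpq)
  · intro p hp
    have hpm := Finset.mem_image_of_mem Prod.fst hp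
    refine ⟨f ⟨p.1, hpm⟩, Finset.mem_filter.2 ⟨?_, hpm, rfl⟩⟩
    obtain ⟨q, hq, hqf⟩ := Finset.mem_image.1 (hft ⟨p.1, hpm⟩)
    obtain ⟨hqF, hq1⟩ := Finset.mem_filter.1 hq
    rw [← hqf, show p.1 = q.1 from hq1.symm]
    exact hqF

namespace SMInstance

variable {A B : Type*}

/-- The set `E*(x)` of support edges `(u,v)` of `x` with `v` maximal for `u` in the support. -/
noncomputable def topEdges (I : SMInstance A B) (x : A × B → ℝ) : Finset (A × B) :=
  I.E.filter (fun p => 0 < x p ∧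
    ∀ i, (p.1, i) ∈ I.E → 0 < x (p.1, i) → ¬ I.SPrefA p.1 i p.2)

theorem mem_topEdges {I : SMInstance A B} {x : A × B → ℝ} {p : A × B} :
    p ∈ I.topEdges x ↔ p ∈ I.E ∧ 0 < x p ∧
      ∀ i, (p.1, i) ∈ I.E → 0 < x (p.1, i) → ¬ I.SPrefA p.1 i p.2 :=
  Finset.mem_filter

theorem exists_mem_topEdges (I : SMInstance A B) (x : A × B → ℝ) {a : A} {b : B}
    (hE : (a, b) ∈ I.E) (hx : 0 < x (a, b)) : ∃ b', (a, b') ∈ I.topEdges x := by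
  let S := I.E.filter (fun p => p.1 = a ∧ 0 < x p)
  obtain ⟨⟨a', b'⟩, hp, hmax⟩ := Finset.exists_max_image S
    (fun p => (S.filter (fun q => I.prefA a p.2 q.2)).card)
    ⟨(a, b), Finset.mem_filter.2 ⟨hE, rfl, hx⟩⟩
  obtain ⟨hpE, rfl, hpx⟩ := Finset.mem_filter.1 hp
  refine ⟨b', mem_topEdges.2 ⟨hpE, hpx, fun i hi hxi hpref => ?_⟩⟩
  have hiS : (a', i) ∈ S := Finset.mem_filter.2 ⟨hi, rfl, hxi⟩
  refine (hmax _ hiS).not_gt (Finset.card_lt_card (Finset.ssubset_iff_of_subset ?_ |>.2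
    ⟨(a', i), Finset.mem_filter.2 ⟨hiS, I.prefA_refl _ _ hi⟩,
      fun hm => hpref.2 (Finset.mem_filter.1 hm).2⟩))
  intro q hq
  obtain ⟨hqS, hq⟩ := Finset.mem_filter.1 hq
  exact Finset.mem_filter.2 ⟨hqS, I.prefA_trans _ _ _ _ hpref.1 hq⟩

theorem StrongFeasible.sum_sPrefA_eq_zero {I : SMInstance A B} {x : A × B → ℝ}
    (hx : I.StrongFeasible x) {p : A × B} (hp : p ∈ I.topEdges x) :
    ∑ q ∈ I.E.filter (fun q => q.1 = p.1 ∧ I.SPrefA p.1 q.2 p.2), x q = 0 := by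
  refine Finset.sum_eq_zero fun q hq => ?_
  obtain ⟨hqE, hq1, hq2⟩ := Finset.mem_filter.1 hq
  obtain ⟨a, b⟩ := q
  obtain rfl : a = p.1 := hq1
  exact (hx.2.2.2.2.2 _).antisymm' (not_lt.1 fun hlt => (mem_topEdges.1 hp).2.2 _ hqE hlt hq2)

/-- The left endpoint of a top edge is least preferred by the right endpoint among its
neighbors in the support. -/
theorem StrongFeasible.prefB_of_mem_topEdges {I : SMInstance A B} {x : A × B → ℝ}
    (hx : I.StrongFeasible x) {a a' : A} {b : B} (hp : (a, b) ∈ I.topEdges x)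
    (hE : (a', b) ∈ I.E) (hpos : 0 < x (a', b)) : I.prefB b a' a := by
  by_contra hn
  have hc := hx.2.2.2.2.1 (a, b) (mem_topEdges.1 hp).1
  have h0 := hx.sum_sPrefA_eq_zero hp
  have hcol := hx.2.2.1 b
  unfold StrongIneqC at hc
  unfold colSum at hcol
  rw [h0, zero_add, ← Finset.sum_union] at hc
  · have hlt : ∑ q ∈ I.E.filter (fun q => q.2 = b ∧ I.SPrefB b q.1 a) ∪
        I.E.filter (fun q => q.2 = b ∧ I.EqB b q.1 a), x q <
        ∑ q ∈ I.E.filter (fun q => q.2 = b), x q := by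
      refine Finset.sum_lt_sum_of_subset (i := (a', b)) ?_ (by simp [hE]) ?_ hpos
        fun q _ _ => hx.2.2.2.2.2 q
      · intro q hq
        simp only [Finset.mem_union, Finset.mem_filter] at hq ⊢
        tauto
      · intro hm
        rcases Finset.mem_union.1 hm with hm | hm <;>
          exact hn (Finset.mem_filter.1 hm).2.2.1
    exact (hlt.trans_le hcol).not_ge hc
  · exact Finset.disjoint_left.2 fun q h₁ h₂ =>
      (Finset.mem_filter.1 h₁).2.2.2 (Finset.mem_filter.1 h₂).2.2.2

/-- For a top edge, the top edges at its right endpoint weigh at most as much as those at its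
left endpoint. -/
theorem StrongFeasible.sum_topEdges_le {I : SMInstance A B} {x : A × B → ℝ}
    (hx : I.StrongFeasible x) {p : A × B} (hp : p ∈ I.topEdges x) :
    ∑ q ∈ (I.topEdges x).filter (fun q => q.2 = p.2), x q ≤
      ∑ q ∈ (I.topEdges x).filter (fun q => q.1 = p.1), x q := by
  have hpt := mem_topEdges.1 hp
  have hb := hx.2.2.2.1 p hpt.1
  unfold StrongIneqB at hb
  rw [hx.sum_sPrefA_eq_zero hp, zero_add] at hb
  have hrow : ∑ q ∈ I.E.filter (fun q => q.1 = p.1 ∧ I.EqA p.1 q.2 p.2), x q ≤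
      ∑ q ∈ (I.topEdges x).filter (fun q => q.1 = p.1), x q := by
    rw [← Finset.sum_filter_ne_zero]
    refine Finset.sum_le_sum_of_subset_of_nonneg (fun q hq => ?_) fun q _ _ => hx.2.2.2.2.2 q
    obtain ⟨hq, hq0⟩ := Finset.mem_filter.1 hq
    obtain ⟨hqE, hq1, hq2⟩ := Finset.mem_filter.1 hq
    refine Finset.mem_filter.2 ⟨mem_topEdges.2
      ⟨hqE, (hx.2.2.2.2.2 q).lt_of_ne' hq0, fun i hi hxi hpref => ?_⟩, hq1⟩
    rw [hq1] at hi hxi hpref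
    exact hpt.2.2 i hi hxi ⟨I.prefA_trans _ _ _ _ hpref.1 hq2.1,
      fun hpi => hpref.2 (I.prefA_trans _ _ _ _ hq2.1 hpi)⟩
  have hcol : ∑ q ∈ I.E.filter (fun q => q.2 = p.2 ∧ I.SPrefB p.2 q.1 p.1), x q +
      ∑ q ∈ (I.topEdges x).filter (fun q => q.2 = p.2), x q ≤ 1 := by
    rw [← Finset.sum_union]
    · refine le_trans (Finset.sum_le_sum_of_subset_of_nonneg ?_
        fun q _ _ => hx.2.2.2.2.2 q) (hx.2.2.1 p.2)
      intro q hq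
      simp only [Finset.mem_union, Finset.mem_filter, mem_topEdges] at hq ⊢
      tauto
    · rw [Finset.disjoint_left]
      rintro ⟨a, b⟩ h₁ h₂
      obtain ⟨-, hb₁, hs⟩ := Finset.mem_filter.1 h₁
      obtain rfl : b = p.2 := hb₁
      exact hs.2 (hx.prefB_of_mem_topEdges (Finset.mem_filter.1 h₂).1 hpt.1 hpt.2.1)
  linarith

end SMInstance

/-- For a feasible solution `x` of the strongly stable matching linear system, the
bipartite graph induced by `E*(x) = {(u,v) : u ∈ U ∩ V⁺, v maximal (w.r.t. ⪰_u) in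
{i : x_{u,i} > 0}}` contains a matching saturating every vertex of `U ∩ V⁺`. -/
theorem strong_feasible_saturating_matching {A B : Type*} (I : SMInstance A B)
    (x : A × B → ℝ) (hx : I.StrongFeasible x) :
    ∃ M : Finset (A × B),
      (∀ p ∈ M, p ∈ I.E ∧ 0 < x p ∧
        ∀ i, (p.1, i) ∈ I.E → 0 < x (p.1, i) → ¬ I.SPrefA p.1 i p.2) ∧
      (∀ p ∈ M, ∀ q ∈ M, p.1 = q.1 → p = q) ∧
      (∀ p ∈ M, ∀ q ∈ M, p.2 = q.2 → p = q) ∧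
      (∀ a : A, (∃ b, (a, b) ∈ I.E ∧ 0 < x (a, b)) → ∃ b, (a, b) ∈ M) := by
  obtain ⟨M, hM, h₁, h₂, hsat⟩ := exists_saturating_matching_of_sum_le_sum (I.topEdges x) x
    (fun p hp => (SMInstance.mem_topEdges.1 hp).2.1) (fun p hp => hx.sum_topEdges_le hp)
  refine ⟨M, fun p hp => SMInstance.mem_topEdges.1 (hM hp), h₁, h₂, ?_⟩
  rintro a ⟨b, hE, hpos⟩
  obtain ⟨b', hb'⟩ := I.exists_mem_topEdges x hE hpos
  exact hsat _ hb'
end
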